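/- arXiv:1305.4772 — 6 statements merged into one kernel-verified Lean document; each statement's English description precedes it below -/
import Mathlib

section
/- Let U, V, W be finite-dimensional complex vector spaces, let α' : U → V, β' : V → U, α : V → W, β : W → V be linear maps, and let λ ∈ ℂ satisfy α' ∘ β' − β ∘ α = λ·id_V. Then for every τ ∈ ℂ and every natural number m, the map β sends the subspace ker((α ∘ β − τ·id_W)^m) of W into the subspace ker((α' ∘ β' − (λ + τ)·id_V)^m) of V. -/
/-- If `α' ∘ β' - β ∘ α = λ • id_V`, then `β` sends `ker ((α ∘ β - τ • id_W)^m)`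
into `ker ((α' ∘ β' - (λ + τ) • id_V)^m)`. -/
theorem stmt_0 (U V W : Type*)
    [AddCommGroup U] [Module ℂ U] [FiniteDimensional ℂ U]
    [AddCommGroup V] [Module ℂ V] [FiniteDimensional ℂ V]
    [AddCommGroup W] [Module ℂ W] [FiniteDimensional ℂ W]
    (α' : U →ₗ[ℂ] V) (β' : V →ₗ[ℂ] U) (α : V →ₗ[ℂ] W) (β : W →ₗ[ℂ] V)
    (lam : ℂ) (h : α' ∘ₗ β' - β ∘ₗ α = lam • LinearMap.id) :
    ∀ (τ : ℂ) (m : ℕ),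
      ∀ x ∈ LinearMap.ker (((α ∘ₗ β : Module.End ℂ W) - τ • 1) ^ m),
        β x ∈ LinearMap.ker (((α' ∘ₗ β' : Module.End ℂ V) - (lam + τ) • 1) ^ m) := by
  intro τ m x hx
  have key : (((α' ∘ₗ β' : Module.End ℂ V) - (lam + τ) • 1) : Module.End ℂ V) ∘ₗ β
      = β ∘ₗ ((α ∘ₗ β : Module.End ℂ W) - τ • 1) := by
    rw [sub_eq_iff_eq_add.mp h]
    ext y
    simp [add_smul]
  have hpow := LinearMap.congr_fun (Module.End.commute_pow_left_of_commute key m) x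
  rw [LinearMap.mem_ker] at hx ⊢
  rw [LinearMap.comp_apply, LinearMap.comp_apply, hx, map_zero] at hpow
  exact hpow
end

section
/- Let U, V, W be finite-dimensional complex vector spaces, let α' : U → V, β' : V → U, α : V → W, β : W → V be linear maps, and let λ ∈ ℂ satisfy α' ∘ β' − β ∘ α = λ·id_V. Then for every τ ∈ ℂ and every natural number m, the map α sends the subspace ker((α' ∘ β' − (λ + τ)·id_V)^m) of V into the subspace ker((α ∘ β − τ·id_W)^m) of W. -/
/-- If `α` intertwines the endomorphisms `f` and `g`, it maps `ker (f ^ m)` into `ker (g ^ m)`. -/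
theorem LinearMap.map_mem_ker_pow_of_comp_eq {R V W : Type*} [Semiring R]
    [AddCommMonoid V] [Module R V] [AddCommMonoid W] [Module R W]
    {f : Module.End R V} {g : Module.End R W} {α : V →ₗ[R] W} (h : g ∘ₗ α = α ∘ₗ f)
    (m : ℕ) {x : V} (hx : x ∈ LinearMap.ker (f ^ m)) : α x ∈ LinearMap.ker (g ^ m) := by
  have hm : (g ^ m) (α x) = α ((f ^ m) x) :=
    LinearMap.congr_fun (Module.End.commute_pow_left_of_commute h m) x
  rw [LinearMap.mem_ker] at hx ⊢
  rw [hm, hx, map_zero]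

/-- If `α' ∘ β' - β ∘ α = λ • id_V`, then `α` sends `ker ((α' ∘ β' - (λ + τ) • id_V)^m)`
into `ker ((α ∘ β - τ • id_W)^m)`. -/
theorem stmt_1 (U V W : Type*)
    [AddCommGroup U] [Module ℂ U] [FiniteDimensional ℂ U]
    [AddCommGroup V] [Module ℂ V] [FiniteDimensional ℂ V]
    [AddCommGroup W] [Module ℂ W] [FiniteDimensional ℂ W]
    (α' : U →ₗ[ℂ] V) (β' : V →ₗ[ℂ] U) (α : V →ₗ[ℂ] W) (β : W →ₗ[ℂ] V)
    (lam : ℂ) (h : α' ∘ₗ β' - β ∘ₗ α = lam • LinearMap.id) :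
    ∀ (τ : ℂ) (m : ℕ),
      ∀ x ∈ LinearMap.ker (((α' ∘ₗ β' : Module.End ℂ V) - (lam + τ) • 1) ^ m),
        α x ∈ LinearMap.ker (((α ∘ₗ β : Module.End ℂ W) - τ • 1) ^ m) := by
  intro τ m x hx
  refine LinearMap.map_mem_ker_pow_of_comp_eq ?_ m hx
  ext v
  have hv : α' (β' v) = lam • v + β (α v) := by
    simpa [sub_eq_iff_eq_add] using LinearMap.congr_fun h v
  simp [hv, add_smul]
end

section
/- Let U, V, W be finite-dimensional complex vector spaces, let α' : U → V, β' : V → U, α : V → W, β : W → V be linear maps, and let λ ∈ ℂ satisfy α' ∘ β' − β ∘ α = λ·id_V. Then for every τ ∈ ℂ with τ ≠ 0: τ is an eigenvalue of α ∘ β : W → W if and only if λ + τ is an eigenvalue of α' ∘ β' : U → U. -/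
namespace Module.End

variable {K V W : Type*} [Field K] [AddCommGroup V] [Module K V] [AddCommGroup W] [Module K W]

theorem HasEigenvalue.comp_swap {f : V →ₗ[K] W} {g : W →ₗ[K] V} {τ : K} (hτ : τ ≠ 0)
    (h : HasEigenvalue (f ∘ₗ g : Module.End K W) τ) :
    HasEigenvalue (g ∘ₗ f : Module.End K V) τ := by
  obtain ⟨w, hw⟩ := h.exists_hasEigenvector
  have hfg : f (g w) = τ • w := hw.apply_eq_smul
  refine hasEigenvalue_of_hasEigenvector (x := g w) ⟨mem_eigenspace_iff.mpr ?_, fun hg => ?_⟩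
  · simp [hfg]
  · rw [hg, map_zero] at hfg
    exact smul_ne_zero hτ hw.2 hfg.symm

theorem hasEigenvalue_comp_comm {f : V →ₗ[K] W} {g : W →ₗ[K] V} {τ : K} (hτ : τ ≠ 0) :
    HasEigenvalue (f ∘ₗ g : Module.End K W) τ ↔ HasEigenvalue (g ∘ₗ f : Module.End K V) τ :=
  ⟨.comp_swap hτ, .comp_swap hτ⟩

theorem hasEigenvalue_smul_id_add_iff (f : Module.End K V) (c τ : K) :
    HasEigenvalue (c • LinearMap.id + f : Module.End K V) (c + τ) ↔ HasEigenvalue f τ := by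
  have heq : eigenspace (c • LinearMap.id + f : Module.End K V) (c + τ) = eigenspace f τ := by
    ext v
    simp [add_smul]
  rw [hasEigenvalue_iff, hasEigenvalue_iff, heq]

end Module.End

/-- If `α' ∘ β' - β ∘ α = λ • id_V` and `τ ≠ 0`, then `τ` is an eigenvalue of
`α ∘ β` iff `λ + τ` is an eigenvalue of `α' ∘ β'`. -/
theorem stmt_3 (U V W : Type*)
    [AddCommGroup U] [Module ℂ U] [FiniteDimensional ℂ U]
    [AddCommGroup V] [Module ℂ V] [FiniteDimensional ℂ V]
    [AddCommGroup W] [Module ℂ W] [FiniteDimensional ℂ W]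
    (α' : U →ₗ[ℂ] V) (β' : V →ₗ[ℂ] U) (α : V →ₗ[ℂ] W) (β : W →ₗ[ℂ] V)
    (lam : ℂ) (h : α' ∘ₗ β' - β ∘ₗ α = lam • LinearMap.id)
    (τ : ℂ) (hτ : τ ≠ 0) :
    Module.End.HasEigenvalue (α ∘ₗ β : Module.End ℂ W) τ ↔
      Module.End.HasEigenvalue (α' ∘ₗ β' : Module.End ℂ V) (lam + τ) := by
  rw [sub_eq_iff_eq_add.mp h, Module.End.hasEigenvalue_smul_id_add_iff]
  exact Module.End.hasEigenvalue_comp_comm hτ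
end

section
/- Let U, V, W, Z be finite-dimensional complex vector spaces, and let α' : U → V, β' : V → U, α : V → W, β : W → V, α'' : W → Z, β'' : Z → W be linear maps with α invertible. Suppose λ, μ ∈ ℂ satisfy α' ∘ β' − β ∘ α = λ·id_V and α ∘ β − β'' ∘ α'' = μ·id_W. Then α' ∘ β' − (α^{−1} ∘ β'') ∘ (α'' ∘ α) = (λ + μ)·id_V. -/
/-- Contraction of a quiver along an invertible edge map `α`: if
`α' ∘ β' − β ∘ α = λ·id_V` and `α ∘ β − β'' ∘ α'' = μ·id_W`, then
`α' ∘ β' − (α⁻¹ ∘ β'') ∘ (α'' ∘ α) = (λ + μ)·id_V`. -/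
theorem stmt_10 (U V W Z : Type*)
    [AddCommGroup U] [Module ℂ U] [FiniteDimensional ℂ U]
    [AddCommGroup V] [Module ℂ V] [FiniteDimensional ℂ V]
    [AddCommGroup W] [Module ℂ W] [FiniteDimensional ℂ W]
    [AddCommGroup Z] [Module ℂ Z] [FiniteDimensional ℂ Z]
    (α' : U →ₗ[ℂ] V) (β' : V →ₗ[ℂ] U) (α : V ≃ₗ[ℂ] W) (β : W →ₗ[ℂ] V)
    (α'' : W →ₗ[ℂ] Z) (β'' : Z →ₗ[ℂ] W) (lam μ : ℂ)
    (h1 : α' ∘ₗ β' - β ∘ₗ (α : V →ₗ[ℂ] W) = lam • LinearMap.id)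
    (h2 : (α : V →ₗ[ℂ] W) ∘ₗ β - β'' ∘ₗ α'' = μ • LinearMap.id) :
    α' ∘ₗ β' -
        ((α.symm : W →ₗ[ℂ] V) ∘ₗ β'') ∘ₗ (α'' ∘ₗ (α : V →ₗ[ℂ] W)) =
      (lam + μ) • LinearMap.id := by
  ext v
  have e1 : α' (β' v) - β (α v) = lam • v := by
    simpa using LinearMap.congr_fun h1 v
  have e2 : α (β (α v)) - β'' (α'' (α v)) = μ • α v := by
    simpa using LinearMap.congr_fun h2 (α v)
  have e3 : β (α v) - α.symm (β'' (α'' (α v))) = μ • v := by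
    simpa using congrArg α.symm e2
  simp only [LinearMap.sub_apply, LinearMap.comp_apply, LinearEquiv.coe_coe,
    LinearMap.smul_apply, LinearMap.id_apply]
  rw [add_smul, ← e1, ← e3, sub_add_sub_cancel]
end

section
/- Let n ≥ 2, let m_1, …, m_n be natural numbers, and for 1 ≤ i ≤ n−1 let α_i : ℂ^{m_i} → ℂ^{m_{i+1}} be injective and β_i : ℂ^{m_{i+1}} → ℂ^{m_i} be surjective linear maps satisfying α_i ∘ β_i = β_{i+1} ∘ α_{i+1} for 1 ≤ i ≤ n−2. Then for every 1 ≤ s ≤ n−1, the rank of (α_{n−1} ∘ β_{n−1})^s : ℂ^{m_n} → ℂ^{m_n} equals m_{n−s}. -/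
namespace LinearMap

variable {K : Type*} [DivisionRing K]

theorem comp_pow_succ {V W : Type*} [AddCommGroup V] [Module K V] [AddCommGroup W] [Module K W]
    (a : V →ₗ[K] W) (b : W →ₗ[K] V) (s : ℕ) :
    (a ∘ₗ b : Module.End K W) ^ (s + 1) = a ∘ₗ ((b ∘ₗ a : Module.End K V) ^ s) ∘ₗ b := by
  induction s with
  | zero => rfl
  | succ s ih => rw [pow_succ, ih, pow_succ]; rfl

theorem finrank_range_comp_pow_succ {V W : Type*} [AddCommGroup V] [Module K V]
    [AddCommGroup W] [Module K W] {a : V →ₗ[K] W} {b : W →ₗ[K] V}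
    (ha : Function.Injective a) (hb : Function.Surjective b) (s : ℕ) :
    Module.finrank K (range ((a ∘ₗ b : Module.End K W) ^ (s + 1))) =
      Module.finrank K (range ((b ∘ₗ a : Module.End K V) ^ s)) := by
  rw [comp_pow_succ, range_comp, range_comp_of_range_eq_top _ (range_eq_top.2 hb)]
  exact (Submodule.equivMapOfInjective a ha _).finrank_eq.symm

/-- In a linear quiver with injective `α i`, surjective `β i` and
`α i ∘ β i = β (i + 1) ∘ α (i + 1)`, the power `(α k ∘ β k) ^ s` has rank `dim V (k + 1 - s)`. -/
theorem finrank_range_quiver_pow {V : ℕ → Type*} [∀ i, AddCommGroup (V i)] [∀ i, Module K (V i)]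
    {N : ℕ} (α : ∀ i, V i →ₗ[K] V (i + 1)) (β : ∀ i, V (i + 1) →ₗ[K] V i)
    (hinj : ∀ i, 1 ≤ i → i ≤ N → Function.Injective (α i))
    (hsurj : ∀ i, 1 ≤ i → i ≤ N → Function.Surjective (β i))
    (heq : ∀ i, 1 ≤ i → i + 1 ≤ N → α i ∘ₗ β i = β (i + 1) ∘ₗ α (i + 1))
    (s k : ℕ) (hsk : s ≤ k) (hk : k ≤ N) :
    Module.finrank K (range ((α k ∘ₗ β k : Module.End K (V (k + 1))) ^ s)) =
      Module.finrank K (V (k + 1 - s)) := by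
  induction s generalizing k with
  | zero => rw [pow_zero, Module.End.one_eq_id, range_id, finrank_top, Nat.sub_zero]
  | succ s ih =>
    rw [finrank_range_comp_pow_succ (hinj k (by omega) hk) (hsurj k (by omega) hk),
      Nat.add_sub_add_right]
    rcases Nat.eq_zero_or_pos s with rfl | hs
    · rw [pow_zero, Module.End.one_eq_id, range_id, finrank_top, Nat.sub_zero]
    · obtain ⟨j, rfl⟩ : ∃ j, k = j + 1 := ⟨k - 1, by omega⟩
      rw [← heq j (by omega) hk]
      exact ih j (by omega) (by omega)

end LinearMap

/-- For a quiver with injective `α_i`, surjective `β_i` and `α_i β_i = β_{i+1} α_{i+1}`,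
the rank of `(α_{n−1} ∘ β_{n−1})^s` equals `m_{n−s}` for `1 ≤ s ≤ n−1`. -/
theorem stmt_12 (n : ℕ) (hn : 2 ≤ n) (m : ℕ → ℕ)
    (hm : ∀ i, 1 ≤ i → i ≤ n - 1 → m i ≤ m (i + 1))
    (α : ∀ i : ℕ, (Fin (m i) → ℂ) →ₗ[ℂ] (Fin (m (i + 1)) → ℂ))
    (β : ∀ i : ℕ, (Fin (m (i + 1)) → ℂ) →ₗ[ℂ] (Fin (m i) → ℂ))
    (hinj : ∀ i, 1 ≤ i → i ≤ n - 1 → Function.Injective (α i))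
    (hsurj : ∀ i, 1 ≤ i → i ≤ n - 1 → Function.Surjective (β i))
    (heq : ∀ i, 1 ≤ i → i ≤ n - 2 → α i ∘ₗ β i = β (i + 1) ∘ₗ α (i + 1)) :
    ∀ s, 1 ≤ s → s ≤ n - 1 →
      Module.finrank ℂ
        (LinearMap.range
          ((α (n - 1) ∘ₗ β (n - 1) : Module.End ℂ (Fin (m ((n - 1) + 1)) → ℂ)) ^ s)) =
        m (n - s) := by
  intro s _ hs
  rw [LinearMap.finrank_range_quiver_pow (V := fun i => Fin (m i) → ℂ) α β hinj hsurj
      (fun i hi hi' => heq i hi (by omega)) s (n - 1) hs le_rfl,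
    Module.finrank_fin_fun, Nat.sub_add_cancel (by omega)]
end

section
/- Let r ≥ 1. For 1 ≤ k ≤ r let α_k ∈ M_{(k+1)×k}(ℂ) be the matrix with (α_k)_{jj} = ν_j^k for 1 ≤ j ≤ k and all other entries zero, and let β_k ∈ M_{k×(k+1)}(ℂ) be the matrix with (β_k)_{jj} = μ_j^k and (β_k)_{j,j+1} = ξ_j^k for 1 ≤ j ≤ k and all other entries zero, where ν_j^k, μ_j^k, ξ_j^k ∈ ℂ. Suppose λ_1, …, λ_r ∈ ℂ satisfy −β_1·α_1 = λ_1 and α_{k−1}·β_{k−1} − β_k·α_k = λ_k·I_k for 2 ≤ k ≤ r. Define β_k^T ∈ M_{k×(k+1)}(ℂ) by (β_k^T)_{jj} = μ_j^k with all other entries zero. Then the same equations hold with every β_k replaced by β_k^T: −β_1^T·α_1 = λ_1 and α_{k−1}·β_{k−1}^T − β_k^T·α_k = λ_k·I_k for 2 ≤ k ≤ r. -/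
/-- Left multiplication by a rectangular diagonal matrix scales the rows and appends a zero row. -/
theorem rectDiagonal_mul_apply {k n : ℕ} {A : Matrix (Fin (k + 1)) (Fin k) ℂ} {d : ℕ → ℂ}
    (hA : ∀ i j, A i j = if (i : ℕ) = (j : ℕ) then d j else 0)
    (B : Matrix (Fin k) (Fin n) ℂ) (i : Fin (k + 1)) (j : Fin n) :
    (A * B) i j = if h : (i : ℕ) < k then d i * B ⟨i, h⟩ j else 0 := by
  rw [Matrix.mul_apply]
  split_ifs with h
  · rw [Finset.sum_eq_single ⟨i, h⟩]
    · simp [hA]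
    · intro l _ hl
      have hil : (i : ℕ) ≠ l := fun e => hl (Fin.ext e.symm)
      simp [hA, hil]
    · simp
  · refine Finset.sum_eq_zero fun l _ => ?_
    have hil : (i : ℕ) ≠ l := by omega
    simp [hA, hil]

/-- Right multiplication by a rectangular diagonal matrix scales the columns and drops the last
one. -/
theorem mul_rectDiagonal_apply {k n : ℕ} {A : Matrix (Fin (k + 1)) (Fin k) ℂ} {d : ℕ → ℂ}
    (hA : ∀ i j, A i j = if (i : ℕ) = (j : ℕ) then d j else 0)
    (B : Matrix (Fin n) (Fin (k + 1)) ℂ) (i : Fin n) (j : Fin k) :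
    (B * A) i j = B i j.castSucc * d j := by
  rw [Matrix.mul_apply, Finset.sum_eq_single j.castSucc]
  · simp [hA]
  · intro l _ hl
    have hlj : (l : ℕ) ≠ j := fun e => hl (Fin.ext e)
    simp [hA, hlj]
  · simp

/-- For a chain of standard-form quiver matrices satisfying the complex moment map
equations, the truncated chain with all superdiagonal entries `ξ_j^k` set to zero
satisfies the same complex moment map equations. -/
theorem stmt_15 (r : ℕ) (hr : 1 ≤ r) (ν μ ξ : ℕ → ℕ → ℂ) (lam : ℕ → ℂ)
    (α : ∀ k : ℕ, Matrix (Fin (k + 1)) (Fin k) ℂ)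
    (β βT : ∀ k : ℕ, Matrix (Fin k) (Fin (k + 1)) ℂ)
    (hα : ∀ k, 1 ≤ k → k ≤ r → ∀ (i : Fin (k + 1)) (j : Fin k),
      α k i j = if (i : ℕ) = (j : ℕ) then ν k (j : ℕ) else 0)
    (hβ : ∀ k, 1 ≤ k → k ≤ r → ∀ (i : Fin k) (j : Fin (k + 1)),
      β k i j = if (j : ℕ) = (i : ℕ) then μ k (i : ℕ)
        else if (j : ℕ) = (i : ℕ) + 1 then ξ k (i : ℕ) else 0)
    (hβT : ∀ k, 1 ≤ k → k ≤ r → ∀ (i : Fin k) (j : Fin (k + 1)),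
      βT k i j = if (j : ℕ) = (i : ℕ) then μ k (i : ℕ) else 0)
    (h1 : -(β 1 * α 1) = lam 1 • (1 : Matrix (Fin 1) (Fin 1) ℂ))
    (heq : ∀ k, 1 ≤ k → k + 1 ≤ r →
      α k * β k - β (k + 1) * α (k + 1) = lam (k + 1) • 1) :
    -(βT 1 * α 1) = lam 1 • (1 : Matrix (Fin 1) (Fin 1) ℂ) ∧
      ∀ k, 1 ≤ k → k + 1 ≤ r →
        α k * βT k - βT (k + 1) * α (k + 1) = lam (k + 1) • 1 := by
  have diag : ∀ k, 1 ≤ k → k ≤ r → ∀ (i : Fin k) (j : Fin (k + 1)), (j : ℕ) = i →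
      βT k i j = β k i j := fun k hk hkr i j hij => by
    rw [hβ k hk hkr, hβT k hk hkr, if_pos hij, if_pos hij]
  have offdiag : ∀ k, 1 ≤ k → k ≤ r → ∀ (i : Fin k) (j : Fin (k + 1)), (j : ℕ) ≠ i →
      βT k i j = 0 := fun k hk hkr i j hij => by
    rw [hβT k hk hkr, if_neg hij]
  constructor
  · rw [← h1]
    ext i j
    have hij : j = i := Subsingleton.elim _ _
    rw [Matrix.neg_apply, Matrix.neg_apply, mul_rectDiagonal_apply (hα 1 le_rfl hr),
      mul_rectDiagonal_apply (hα 1 le_rfl hr), diag 1 le_rfl hr _ _ (by simp [hij])]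
  · intro k hk hkr
    have hk' : k ≤ r := by omega
    have hk1 : 1 ≤ k + 1 := by omega
    ext i j
    by_cases hij : j = i
    · rw [← heq k hk hkr, Matrix.sub_apply, Matrix.sub_apply,
        mul_rectDiagonal_apply (hα _ hk1 hkr), mul_rectDiagonal_apply (hα _ hk1 hkr),
        rectDiagonal_mul_apply (hα k hk hk'), rectDiagonal_mul_apply (hα k hk hk'),
        diag _ hk1 hkr _ _ (by simp [hij])]
      split_ifs with h
      · rw [diag k hk hk' _ _ (by simp [hij])]
      · rfl
    · have hval : (j : ℕ) ≠ i := fun e => hij (Fin.ext e)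
      rw [Matrix.sub_apply, mul_rectDiagonal_apply (hα _ hk1 hkr),
        rectDiagonal_mul_apply (hα k hk hk'), offdiag _ hk1 hkr _ _ (by simpa using hval),
        Matrix.smul_apply, Matrix.one_apply_ne (Ne.symm hij)]
      split_ifs with h
      · rw [offdiag k hk hk' _ _ hval]
        simp
      · simp
end
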